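/- (One epoch of mS2GD contracts in expectation.) Fix m ≥ 1, b ∈ {1,…,n}, and a stepsize h with 0 < h ≤ 1/L and 4hLα(b) < 1, where α(b) = (n−b)/(b(n−1)). Let A_0,…,A_{m−1} be independent subsets of {1,…,n}, each of cardinality b and uniformly distributed among all such subsets, and let T be uniformly distributed on {1,…,m}, independent of the A_t. Given x_0 ∈ ℝ^d, define y_0 = x_0 and, for t = 0,…,m−1, y_{t+1} = prox_{hR}( y_t − h·( ∇F(x_0) + (1/b)∑_{i∈A_t}(∇f_i(y_t) − ∇f_i(x_0)) ) ), and set x_1 = y_T. Then E[P(x_1) − P(x*)] ≤ ρ·( P(x_0) − P(x*) ), where ρ = 1/( m·h·μ·(1 − 4hLα(b)) ) + 4hLα(b)·(m+1) / ( m·(1 − 4hLα(b)) ). -/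

import Mathlib

section FirstOrder

variable {E : Type*} [NormedAddCommGroup E] [InnerProductSpace ℝ E]

theorem nonneg_of_forall_quadratic_nonneg {a c : ℝ}
    (H : ∀ s : ℝ, 0 < s → s ≤ 1 → 0 ≤ s * a + s ^ 2 * c) : 0 ≤ a := by
  by_contra! ha
  have hc : 0 < 2 * (|c| + 1) := by positivity
  set s := min 1 (-a / (2 * (|c| + 1)))
  have hs : 0 < s := lt_min one_pos (div_pos (neg_pos.2 ha) hc)
  have hs1 : s * (2 * (|c| + 1)) ≤ -a := (le_div_iff₀ hc).1 (min_le_right _ _)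
  have hq : 0 ≤ s * (a + s * c) := by linarith [H s hs (min_le_left _ _)]
  have hq' : 0 ≤ a + s * c := nonneg_of_mul_nonneg_right hq hs
  nlinarith [mul_le_mul_of_nonneg_left (le_abs_self c) hs.le]

theorem ConvexOn.map_add_smul_sub_le {g : E → ℝ} (hg : ConvexOn ℝ Set.univ g) (x y : E) {s : ℝ}
    (hs : 0 ≤ s) (hs1 : s ≤ 1) : g (x + s • (y - x)) ≤ (1 - s) * g x + s * g y := by
  rw [show x + s • (y - x) = (1 - s) • x + s • y by module]
  exact hg.2 (Set.mem_univ x) (Set.mem_univ y) (sub_nonneg.2 hs1) hs (by ring)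

theorem inner_le_of_isMinOn_prox {R : E → ℝ} (hR : ConvexOn ℝ Set.univ R) {h : ℝ} (hh : 0 ≤ h)
    {z p : E} (hp : ∀ w, (1 / 2) * ‖p - z‖ ^ 2 + h * R p ≤ (1 / 2) * ‖w - z‖ ^ 2 + h * R w)
    (w : E) : inner ℝ (z - p) (w - p) ≤ h * (R w - R p) := by
  suffices 0 ≤ h * (R w - R p) - inner ℝ (z - p) (w - p) by linarith
  refine nonneg_of_forall_quadratic_nonneg (c := ‖w - p‖ ^ 2 / 2) fun s hs hs1 ↦ ?_
  have h1 := hp (p + s • (w - p))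
  have h2 := mul_le_mul_of_nonneg_left (hR.map_add_smul_sub_le p w hs.le hs1) hh
  have h3 : p + s • (w - p) - z = s • (w - p) - (z - p) := by abel
  rw [h3, norm_sub_rev p z, norm_sub_sq_real (s • (w - p)), norm_smul, Real.norm_of_nonneg hs.le,
    real_inner_smul_left, real_inner_comm] at h1
  linarith

theorem norm_sub_le_of_isMinOn_prox {R : E → ℝ} (hR : ConvexOn ℝ Set.univ R) {h : ℝ} (hh : 0 ≤ h)
    {prox : E → E} (hprox : ∀ z w, (1 / 2) * ‖prox z - z‖ ^ 2 + h * R (prox z)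
        ≤ (1 / 2) * ‖w - z‖ ^ 2 + h * R w) (z w : E) :
    ‖prox z - prox w‖ ≤ ‖z - w‖ := by
  have h1 := inner_le_of_isMinOn_prox hR hh (hprox z) (prox w)
  have h2 := inner_le_of_isMinOn_prox hR hh (hprox w) (prox z)
  have h3 : inner ℝ (z - prox z) (prox w - prox z) + inner ℝ (w - prox w) (prox z - prox w)
      = ‖prox z - prox w‖ ^ 2 - inner ℝ (z - w) (prox z - prox w) := by
    rw [← real_inner_self_eq_norm_sq, ← neg_sub (prox z) (prox w), inner_neg_right]
    simp only [inner_sub_left]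
    ring
  have h4 := real_inner_le_norm (z - w) (prox z - prox w)
  by_contra! hlt
  nlinarith [norm_nonneg (z - w)]

theorem sq_norm_sub_le_of_strongly_convex {P : E → ℝ} {μ : ℝ}
    (hP : ConvexOn ℝ Set.univ fun x ↦ P x - μ / 2 * ‖x‖ ^ 2) {z : E} (hz : ∀ x, P z ≤ P x)
    (x : E) : μ / 2 * ‖x - z‖ ^ 2 ≤ P x - P z := by
  suffices 0 ≤ P x - P z - μ / 2 * ‖x - z‖ ^ 2 by linarith
  refine nonneg_of_forall_quadratic_nonneg (c := μ / 2 * ‖x - z‖ ^ 2) fun s hs hs1 ↦ ?_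
  have h1 := hP.map_add_smul_sub_le z x hs.le hs1
  have h2 := hz (z + s • (x - z))
  have h3 : ‖z + s • (x - z)‖ ^ 2
      = (1 - s) * ‖z‖ ^ 2 + s * ‖x‖ ^ 2 - s * (1 - s) * ‖x - z‖ ^ 2 := by
    rw [norm_add_sq_real, norm_smul, Real.norm_of_nonneg hs.le, real_inner_smul_right,
      inner_sub_right, mul_pow, norm_sub_sq_real, real_inner_self_eq_norm_sq,
      real_inner_comm z x]
    ring
  simp only [h3] at h1
  linarith

theorem sq_norm_sub_prox_le {F R P : E → ℝ} {F' : E → E} {L h : ℝ}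
    (hlow : ∀ x y, F x + inner ℝ (F' x) (y - x) ≤ F y)
    (hup : ∀ x y, F y ≤ F x + inner ℝ (F' x) (y - x) + L / 2 * ‖y - x‖ ^ 2)
    (hR : ConvexOn ℝ Set.univ R) (hP : ∀ x, P x = F x + R x) (hh : 0 < h) (hhL : h * L ≤ 1)
    {prox : E → E} (hprox : ∀ z w, (1 / 2) * ‖prox z - z‖ ^ 2 + h * R (prox z)
        ≤ (1 / 2) * ‖w - z‖ ^ 2 + h * R w) (z y Δ : E) :
    ‖prox (y - h • (F' y + Δ)) - z‖ ^ 2 + 2 * h * (P (prox (y - h • (F' y + Δ))) - P z)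
      ≤ ‖y - z‖ ^ 2 + 2 * h ^ 2 * ‖Δ‖ ^ 2
        - 2 * h * inner ℝ Δ (prox (y - h • F' y) - z) := by
  have hne := norm_sub_le_of_isMinOn_prox hR hh.le hprox (y - h • F' y) (y - h • (F' y + Δ))
  rw [show y - h • F' y - (y - h • (F' y + Δ)) = h • Δ by module, norm_smul,
    Real.norm_of_nonneg hh.le] at hne
  have hopt := inner_le_of_isMinOn_prox hR hh.le (hprox (y - h • (F' y + Δ))) z
  set p := prox (y - h • (F' y + Δ))
  set q := prox (y - h • F' y)
  have h1 := hlow y z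
  have h2 := hup y p
  have h3 : inner ℝ (y - h • (F' y + Δ) - p) (z - p)
      = (‖y - p‖ ^ 2 + ‖p - z‖ ^ 2 - ‖y - z‖ ^ 2) / 2
        - h * (inner ℝ (F' y) (z - p) + inner ℝ Δ (z - p)) := by
    have : ‖y - z‖ ^ 2 = ‖(y - p) - (z - p)‖ ^ 2 := by congr 2; abel
    rw [this, norm_sub_sq_real (y - p), norm_sub_rev p z, ← inner_add_left,
      ← real_inner_smul_left (F' y + Δ), sub_right_comm, inner_sub_left]
    ring
  have h4 : inner ℝ (F' y) (z - y) - inner ℝ (F' y) (p - y) = inner ℝ (F' y) (z - p) := by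
    rw [← inner_sub_right]; congr 1; abel
  have h5 : inner ℝ Δ (z - p) = inner ℝ Δ (q - p) - inner ℝ Δ (q - z) := by
    rw [← inner_sub_right]; congr 1; abel
  have h6 : inner ℝ Δ (q - p) ≤ h * ‖Δ‖ ^ 2 :=
    (real_inner_le_norm _ _).trans
      ((mul_le_mul_of_nonneg_left hne (norm_nonneg _)).trans_eq (by ring))
  have h7 : h * L * ‖p - y‖ ^ 2 ≤ ‖y - p‖ ^ 2 := by
    rw [norm_sub_rev y p]; exact mul_le_of_le_one_left (by positivity) hhL
  rw [h3] at hopt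
  have h8 : h * (F p + inner ℝ (F' y) (z - p) - L / 2 * ‖p - y‖ ^ 2) ≤ h * F z :=
    mul_le_mul_of_nonneg_left (by linarith) hh.le
  have h9 := mul_le_mul_of_nonneg_left h6 hh.le
  rw [hP, hP]
  rw [h5] at hopt
  linarith

theorem neg_inner_le_of_isMin_add {F R P : E → ℝ} {g : E} {c : ℝ} {z : E}
    (hup : ∀ y, F y ≤ F z + inner ℝ g (y - z) + c * ‖y - z‖ ^ 2)
    (hR : ConvexOn ℝ Set.univ R) (hP : ∀ x, P x = F x + R x) (hz : ∀ x, P z ≤ P x) (x : E) :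
    -inner ℝ g (x - z) ≤ R x - R z := by
  suffices 0 ≤ inner ℝ g (x - z) + (R x - R z) by linarith
  refine nonneg_of_forall_quadratic_nonneg (c := c * ‖x - z‖ ^ 2) fun s hs hs1 ↦ ?_
  have h1 := hR.map_add_smul_sub_le z x hs.le hs1
  have h2 := hz (z + s • (x - z))
  have h3 := hup (z + s • (x - z))
  rw [add_sub_cancel_left, real_inner_smul_right, norm_smul, Real.norm_of_nonneg hs.le] at h3
  rw [hP, hP] at h2
  linarith

variable [CompleteSpace E]

theorem HasGradientAt.le_add_inner_add_sq {f : E → ℝ} {f' : E → E} {L : ℝ}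
    (hf : ∀ x, HasGradientAt f (f' x) x) (hL : ∀ x y, ‖f' x - f' y‖ ≤ L * ‖x - y‖) (x y : E) :
    f y ≤ f x + inner ℝ (f' x) (y - x) + L / 2 * ‖y - x‖ ^ 2 := by
  set v := y - x
  have hder : ∀ t : ℝ, HasDerivAt
      (fun t : ℝ ↦ f (x + t • v) - t * inner ℝ (f' x) v - L / 2 * ‖v‖ ^ 2 * t ^ 2)
      (inner ℝ (f' (x + t • v)) v - inner ℝ (f' x) v - L / 2 * ‖v‖ ^ 2 * (2 * t)) t := by
    intro t
    have h1 : HasDerivAt (fun t : ℝ ↦ x + t • v) v t := by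
      simpa using ((hasDerivAt_id t).smul_const v).const_add x
    have h2 := (hf (x + t • v)).hasFDerivAt.comp_hasDerivAt t h1
    have h3 := (hasDerivAt_id t).mul_const (inner ℝ (f' x) v)
    have h4 := ((hasDerivAt_pow 2 t).const_mul (L / 2 * ‖v‖ ^ 2))
    exact ((h2.sub h3).sub h4).congr_deriv (by simp)
  have hanti : AntitoneOn
      (fun t : ℝ ↦ f (x + t • v) - t * inner ℝ (f' x) v - L / 2 * ‖v‖ ^ 2 * t ^ 2)
      (Set.Icc 0 1) := by
    refine antitoneOn_of_deriv_nonpos (convex_Icc 0 1)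
      (fun t _ ↦ (hder t).continuousAt.continuousWithinAt)
      (fun t _ ↦ (hder t).differentiableAt.differentiableWithinAt) fun t ht ↦ ?_
    rw [interior_Icc] at ht
    rw [(hder t).deriv, ← inner_sub_left]
    have h1 := real_inner_le_norm (f' (x + t • v) - f' x) v
    have h2 := hL (x + t • v) x
    rw [add_sub_cancel_left, norm_smul, Real.norm_of_nonneg ht.1.le] at h2
    nlinarith [mul_le_mul_of_nonneg_right h2 (norm_nonneg v)]
  have := hanti (Set.left_mem_Icc.2 zero_le_one) (Set.right_mem_Icc.2 zero_le_one) zero_le_one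
  simp only [one_smul, zero_smul, add_zero, v, add_sub_cancel] at this
  simp only [v]
  linarith

theorem ConvexOn.add_inner_le_of_hasGradientAt {f : E → ℝ} {f' : E → E} {L : ℝ}
    (hc : ConvexOn ℝ Set.univ f) (hf : ∀ x, HasGradientAt f (f' x) x)
    (hL : ∀ x y, ‖f' x - f' y‖ ≤ L * ‖x - y‖) (x y : E) :
    f x + inner ℝ (f' x) (y - x) ≤ f y := by
  suffices 0 ≤ f y - f x - inner ℝ (f' x) (y - x) by linarith
  refine nonneg_of_forall_quadratic_nonneg (c := L / 2 * ‖y - x‖ ^ 2) fun s hs hs1 ↦ ?_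
  have h1 := hc.map_add_smul_sub_le x y hs.le hs1
  have hneg : ∀ x, HasGradientAt (fun x ↦ -f x) (-f' x) x := fun x ↦ by
    rw [hasGradientAt_iff_hasFDerivAt, map_neg]
    exact (hf x).hasFDerivAt.neg
  have h2 := HasGradientAt.le_add_inner_add_sq hneg
    (fun x y ↦ by rw [← neg_sub', norm_neg]; exact hL x y) x (x + s • (y - x))
  rw [add_sub_cancel_left, real_inner_smul_right, norm_smul, Real.norm_of_nonneg hs.le,
    inner_neg_left] at h2
  linarith

theorem ConvexOn.sq_norm_gradient_sub_le {f : E → ℝ} {f' : E → E} {L : ℝ} (hL0 : 0 < L)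
    (hc : ConvexOn ℝ Set.univ f) (hf : ∀ x, HasGradientAt f (f' x) x)
    (hL : ∀ x y, ‖f' x - f' y‖ ≤ L * ‖x - y‖) (x y : E) :
    ‖f' x - f' y‖ ^ 2 ≤ 2 * L * (f x - f y - inner ℝ (f' y) (x - y)) := by
  set g := f' x - f' y
  have h1 := hc.add_inner_le_of_hasGradientAt hf hL y (x - L⁻¹ • g)
  have h2 := HasGradientAt.le_add_inner_add_sq hf hL x (x - L⁻¹ • g)
  rw [sub_sub_cancel_left, inner_neg_right, norm_neg, norm_smul, real_inner_smul_right,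
    Real.norm_of_nonneg (by positivity)] at h2
  rw [sub_right_comm, inner_sub_right, real_inner_smul_right] at h1
  have h3 : inner ℝ (f' x) g - inner ℝ (f' y) g = ‖g‖ ^ 2 := by
    rw [← inner_sub_left, real_inner_self_eq_norm_sq]
  have h4 : L⁻¹ * ‖g‖ ^ 2 - L / 2 * (L⁻¹ * ‖g‖) ^ 2 ≤ f x - f y - inner ℝ (f' y) (x - y) := by
    linarith [congrArg (L⁻¹ * ·) h3]
  have h5 : L⁻¹ * ‖g‖ ^ 2 - L / 2 * (L⁻¹ * ‖g‖) ^ 2 = ‖g‖ ^ 2 / (2 * L) := by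
    field_simp; ring
  rw [h5, div_le_iff₀ (by positivity)] at h4
  linarith

end FirstOrder

section Sampling

open Finset

variable {ι E : Type*} [Fintype ι] [NormedAddCommGroup E] [InnerProductSpace ℝ E]

theorem sum_sq_norm_sub_mean_le (a : ι → E) :
    ∑ i, ‖a i - (Fintype.card ι : ℝ)⁻¹ • ∑ j, a j‖ ^ 2 ≤ ∑ i, ‖a i‖ ^ 2 := by
  rcases isEmpty_or_nonempty ι with _ | _
  · simp
  have hn : (Fintype.card ι : ℝ) ≠ 0 := Nat.cast_ne_zero.2 Fintype.card_ne_zero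
  set e := (Fintype.card ι : ℝ)⁻¹ • ∑ j, a j with he
  have hs : ∑ j, a j = (Fintype.card ι : ℝ) • e := by rw [he, smul_inv_smul₀ hn]
  simp_rw [norm_sub_sq_real, sum_add_distrib, sum_sub_distrib, ← mul_sum, ← sum_inner]
  rw [hs, real_inner_smul_left, real_inner_self_eq_norm_sq, sum_const, card_univ, nsmul_eq_mul]
  have : 0 ≤ (Fintype.card ι : ℝ) * ‖e‖ ^ 2 := by positivity
  linarith

variable [DecidableEq ι]

theorem card_mul_card_filter_mem_powersetCard {b : ℕ} (hb : 1 ≤ b) (i : ι) :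
    Fintype.card ι * #{S ∈ powersetCard b (univ : Finset ι) | i ∈ S}
      = b * #(powersetCard b (univ : Finset ι)) := by
  have h := card_filter_powersetCard_subset {i} univ b (subset_univ _) (by simpa using hb)
  simp only [singleton_subset_iff, card_singleton, card_univ] at h
  have hn : 1 ≤ Fintype.card ι := Fintype.card_pos_iff.2 ⟨i⟩
  rw [h, card_powersetCard, card_univ]
  obtain ⟨b, rfl⟩ := Nat.exists_eq_add_of_le' hb
  obtain ⟨n, hn⟩ := Nat.exists_eq_add_of_le' hn
  rw [hn, Nat.add_sub_cancel, Nat.add_sub_cancel, Nat.add_one_mul_choose_eq, mul_comm]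

theorem card_mul_card_filter_mem_mem_powersetCard (b : ℕ) {i j : ι} (hij : i ≠ j) :
    Fintype.card ι * (Fintype.card ι - 1) * #{S ∈ powersetCard b (univ : Finset ι) | i ∈ S ∧ j ∈ S}
      = b * (b - 1) * #(powersetCard b (univ : Finset ι)) := by
  have hn : 2 ≤ Fintype.card ι := by
    simpa [card_pair hij] using card_le_univ ({i, j} : Finset ι)
  rcases lt_or_ge b 2 with hb | hb
  · have : b * (b - 1) = 0 := by interval_cases b <;> rfl
    rw [this, zero_mul, mul_eq_zero, card_eq_zero, filter_eq_empty_iff]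
    right
    rintro S hS ⟨hi, hj⟩
    have := card_le_card (insert_subset hi (singleton_subset_iff.2 hj))
    rw [card_pair hij, (mem_powersetCard.1 hS).2] at this
    omega
  · have h := card_filter_powersetCard_subset {i, j} univ b (subset_univ _)
      (by simpa [card_pair hij] using hb)
    simp only [insert_subset_iff, singleton_subset_iff, card_pair hij, card_univ] at h
    rw [h, card_powersetCard, card_univ]
    obtain ⟨b, rfl⟩ := Nat.exists_eq_add_of_le' hb
    obtain ⟨n, hn⟩ := Nat.exists_eq_add_of_le' hn
    rw [hn]
    have h1 := Nat.add_one_mul_choose_eq (n + 1) (b + 1)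
    have h2 := Nat.add_one_mul_choose_eq n b
    simp only [Nat.add_sub_cancel, show n + 2 - 1 = n + 1 by omega,
      show b + 2 - 1 = b + 1 by omega]
    rw [mul_assoc, h2]
    linear_combination (b + 1) * h1

theorem sum_powersetCard_sum_eq_zero {b : ℕ}
    (hb : 1 ≤ b) {c : ι → E} (hc : ∑ i, c i = 0) :
    ∑ S ∈ powersetCard b (univ : Finset ι), ∑ i ∈ S, c i = 0 := by
  have h1 : ∀ S : Finset ι, ∑ i ∈ S, c i = ∑ i, if i ∈ S then c i else 0 := fun S ↦ by
    rw [sum_ite_mem, univ_inter]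
  simp_rw [h1]
  rw [sum_comm]
  have h2 : ∀ i, (∑ S ∈ powersetCard b (univ : Finset ι), if i ∈ S then c i else 0)
      = ((b * #(powersetCard b (univ : Finset ι)) : ℝ) / Fintype.card ι) • c i := by
    intro i
    have hn : (Fintype.card ι : ℝ) ≠ 0 :=
      Nat.cast_ne_zero.2 (Fintype.card_pos_iff.2 ⟨i⟩).ne'
    have := card_mul_card_filter_mem_powersetCard hb i
    rw [← sum_filter, sum_const, ← Nat.cast_smul_eq_nsmul ℝ]
    congr 1
    rw [eq_div_iff hn]
    exact_mod_cast (mul_comm _ _).trans this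
  simp_rw [h2]
  rw [← smul_sum, hc, smul_zero]

theorem sum_powersetCard_sq_norm_sum {b : ℕ} (hb : 1 ≤ b) {c : ι → E} (hc : ∑ i, c i = 0) :
    (Fintype.card ι : ℝ) * (Fintype.card ι - 1)
        * ∑ S ∈ powersetCard b (univ : Finset ι), ‖∑ i ∈ S, c i‖ ^ 2
      = #(powersetCard b (univ : Finset ι)) * (b * (Fintype.card ι - b)) * ∑ i, ‖c i‖ ^ 2 := by
  set n := (Fintype.card ι : ℝ)
  set N := (#(powersetCard b (univ : Finset ι)) : ℝ)
  have h1 : ∀ S : Finset ι, ‖∑ i ∈ S, c i‖ ^ 2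
      = ∑ i, ∑ j, if i ∈ S ∧ j ∈ S then inner ℝ (c i) (c j) else 0 := fun S ↦ by
    rw [← real_inner_self_eq_norm_sq, sum_inner]
    simp_rw [inner_sum]
    trans ∑ i, if i ∈ S then ∑ j ∈ S, inner ℝ (c i) (c j) else 0
    · rw [sum_ite_mem, univ_inter]
    · refine sum_congr rfl fun i _ ↦ ?_
      split_ifs with hi <;> simp [hi]
  have h2 : ∀ i j, n * (n - 1) * ∑ S ∈ powersetCard b (univ : Finset ι),
      (if i ∈ S ∧ j ∈ S then inner ℝ (c i) (c j) else 0)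
      = N * (b * (b - 1)) * inner ℝ (c i) (c j)
        + if i = j then N * (b * (n - b)) * inner ℝ (c i) (c j) else 0 := by
    intro i j
    have hn : 1 ≤ Fintype.card ι := Fintype.card_pos_iff.2 ⟨i⟩
    rw [← sum_filter, sum_const, nsmul_eq_mul]
    split_ifs with hij
    · subst hij
      have h := congrArg (Nat.cast : ℕ → ℝ) (card_mul_card_filter_mem_powersetCard hb i)
      push_cast at h
      simp only [and_self]
      linear_combination (n - 1) * inner ℝ (c i) (c i) * h
    · have h := congrArg (Nat.cast : ℕ → ℝ) (card_mul_card_filter_mem_mem_powersetCard b hij)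
      push_cast [Nat.cast_sub hn, Nat.cast_sub hb] at h
      linear_combination inner ℝ (c i) (c j) * h
  calc _ = ∑ i, ∑ j, n * (n - 1) * ∑ S ∈ powersetCard b (univ : Finset ι),
      (if i ∈ S ∧ j ∈ S then inner ℝ (c i) (c j) else 0) := by
        simp_rw [h1, ← mul_sum]
        rw [sum_comm]
        congr 1
        exact sum_congr rfl fun i _ ↦ sum_comm
    _ = _ := by
        simp_rw [h2, sum_add_distrib, ← mul_sum, ← inner_sum, hc, inner_zero_right]
        simp [mul_sum]

theorem sum_piFinset_sum_apply_eq {κ M : Type*} [AddCommMonoid M] (s : Finset κ) (t : ι)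
    {g : (ι → κ) → κ → M} (hg : ∀ A k, g (Function.update A t k) = g A) :
    ∑ A ∈ Fintype.piFinset fun _ ↦ s, ∑ k ∈ s, g A k
      = #s • ∑ A ∈ Fintype.piFinset fun _ ↦ s, g A (A t) := by
  rw [smul_sum]
  simp_rw [← sum_const]
  rw [← sum_product', ← sum_product']
  have hmem : ∀ p ∈ (Fintype.piFinset fun _ : ι ↦ s) ×ˢ s,
      (Function.update p.1 t p.2, p.1 t) ∈ (Fintype.piFinset fun _ : ι ↦ s) ×ˢ s := by
    simp only [mem_product, Fintype.mem_piFinset]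
    rintro p ⟨h1, h2⟩
    refine ⟨fun i ↦ ?_, h1 t⟩
    rcases eq_or_ne i t with rfl | hi
    · simpa using h2
    · simpa [hi] using h1 i
  exact sum_nbij' (fun p ↦ (Function.update p.1 t p.2, p.1 t))
    (fun p ↦ (Function.update p.1 t p.2, p.1 t)) hmem hmem (by simp) (by simp) (by simp [hg])

end Sampling

section MinibatchStep

open Finset

variable {E : Type*} [NormedAddCommGroup E] [InnerProductSpace ℝ E]

theorem sum_powersetCard_proximal_step_le {n b : ℕ} (hn : 2 ≤ n) (hb : 1 ≤ b) (hbn : b ≤ n)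
    {F R P : E → ℝ} {F' : E → E} {L h : ℝ}
    (hlow : ∀ x y, F x + inner ℝ (F' x) (y - x) ≤ F y)
    (hup : ∀ x y, F y ≤ F x + inner ℝ (F' x) (y - x) + L / 2 * ‖y - x‖ ^ 2)
    (hR : ConvexOn ℝ Set.univ R) (hP : ∀ x, P x = F x + R x) (hh : 0 < h) (hhL : h * L ≤ 1)
    {prox : E → E} (hprox : ∀ z w, (1 / 2) * ‖prox z - z‖ ^ 2 + h * R (prox z)
        ≤ (1 / 2) * ‖w - z‖ ^ 2 + h * R w) (z y : E) (a : Fin n → E) {p : Finset (Fin n) → E}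
    (hp : ∀ S, p S = prox (y - h • ((F' y - (n : ℝ)⁻¹ • ∑ i, a i) + (b : ℝ)⁻¹ • ∑ i ∈ S, a i))) :
    ∑ S ∈ powersetCard b (univ : Finset (Fin n)), (‖p S - z‖ ^ 2 + 2 * h * (P (p S) - P z))
      ≤ #(powersetCard b (univ : Finset (Fin n))) * (‖y - z‖ ^ 2
        + 2 * h ^ 2 * (((n : ℝ) - b) / (b * ((n : ℝ) - 1)) * ((n : ℝ)⁻¹ * ∑ i, ‖a i‖ ^ 2))) := by
  have hn2 : (2 : ℝ) ≤ n := mod_cast hn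
  have hn0 : (0 : ℝ) < n := by linarith
  have hn1 : (0 : ℝ) < n - 1 := by linarith
  have hb0 : (0 : ℝ) < b := mod_cast hb
  have hnb : (0 : ℝ) ≤ n - b := sub_nonneg.2 (mod_cast hbn)
  set N := (#(powersetCard b (univ : Finset (Fin n))) : ℝ)
  have hN0 : 0 ≤ N := Nat.cast_nonneg _
  set c : Fin n → E := fun i ↦ a i - (n : ℝ)⁻¹ • ∑ j, a j with hcdef
  have hc : ∑ i, c i = 0 := by
    simp only [hcdef, sum_sub_distrib, sum_const, card_univ, Fintype.card_fin]
    rw [← Nat.cast_smul_eq_nsmul ℝ, smul_inv_smul₀ hn0.ne', sub_self]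
  set D : Finset (Fin n) → E := fun S ↦ (b : ℝ)⁻¹ • ∑ i ∈ S, c i with hD
  have hstep : ∀ S ∈ powersetCard b (univ : Finset (Fin n)), p S = prox (y - h • (F' y + D S)) := by
    intro S hS
    simp only [hp, hD, hcdef, sum_sub_distrib, sum_const, (mem_powersetCard.1 hS).2]
    rw [← Nat.cast_smul_eq_nsmul ℝ b, smul_sub (b : ℝ)⁻¹, inv_smul_smul₀ hb0.ne']
    congr 3
    abel
  have hD0 : ∑ S ∈ powersetCard b (univ : Finset (Fin n)), D S = 0 := by
    rw [← smul_sum, sum_powersetCard_sum_eq_zero hb hc, smul_zero]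
  have hvar : ∑ S ∈ powersetCard b (univ : Finset (Fin n)), ‖D S‖ ^ 2
      ≤ N * (((n : ℝ) - b) / (b * ((n : ℝ) - 1)) * ((n : ℝ)⁻¹ * ∑ i, ‖a i‖ ^ 2)) := by
    have h1 := sum_powersetCard_sq_norm_sum hb hc
    have h2 := sum_sq_norm_sub_mean_le a
    rw [Fintype.card_fin] at h1 h2
    have h3 : ∑ S ∈ powersetCard b (univ : Finset (Fin n)), ‖D S‖ ^ 2
        = N * (((n : ℝ) - b) / (b * ((n : ℝ) - 1)) * ((n : ℝ)⁻¹ * ∑ i, ‖c i‖ ^ 2)) := by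
      simp only [hD, norm_smul, mul_pow, ← mul_sum]
      rw [norm_inv, Real.norm_of_nonneg hb0.le]
      field_simp
      linear_combination h1
    rw [h3]
    gcongr
  calc _ ≤ ∑ S ∈ powersetCard b (univ : Finset (Fin n)), (‖y - z‖ ^ 2 + 2 * h ^ 2 * ‖D S‖ ^ 2
        - 2 * h * inner ℝ (D S) (prox (y - h • F' y) - z)) := by
        refine sum_le_sum fun S hS ↦ ?_
        rw [hstep S hS]
        exact sq_norm_sub_prox_le hlow hup hR hP hh hhL hprox z y (D S)
    _ = N * ‖y - z‖ ^ 2 + 2 * h ^ 2 * ∑ S ∈ powersetCard b (univ : Finset (Fin n)), ‖D S‖ ^ 2 := by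
        rw [sum_sub_distrib, sum_add_distrib, ← mul_sum, ← mul_sum, ← sum_inner, hD0,
          inner_zero_left, sum_const, nsmul_eq_mul]
        ring
    _ ≤ _ := by
        rw [mul_add]
        have := mul_le_mul_of_nonneg_left hvar (by positivity : 0 ≤ 2 * h ^ 2)
        linarith

theorem sum_sq_norm_gradient_sub_le [CompleteSpace E] {n : ℕ} {f : Fin n → E → ℝ}
    {f' : Fin n → E → E} {F R P : E → ℝ} {F' : E → E} {L : ℝ} (hL : 0 < L)
    (hconv : ∀ i, ConvexOn ℝ Set.univ (f i)) (hgrad : ∀ i x, HasGradientAt (f i) (f' i x) x)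
    (hlip : ∀ i x y, ‖f' i x - f' i y‖ ≤ L * ‖x - y‖)
    (hF : ∀ x, F x = (n : ℝ)⁻¹ * ∑ i, f i x) (hF' : ∀ x, F' x = (n : ℝ)⁻¹ • ∑ i, f' i x)
    (hup : ∀ x y, F y ≤ F x + inner ℝ (F' x) (y - x) + L / 2 * ‖y - x‖ ^ 2)
    (hR : ConvexOn ℝ Set.univ R) (hP : ∀ x, P x = F x + R x) {z : E} (hz : ∀ x, P z ≤ P x)
    (x : E) : (n : ℝ)⁻¹ * ∑ i, ‖f' i x - f' i z‖ ^ 2 ≤ 2 * L * (P x - P z) := by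
  have hopt := neg_inner_le_of_isMin_add (hup z) hR hP hz x
  calc _ ≤ (n : ℝ)⁻¹ * ∑ i, 2 * L * (f i x - f i z - inner ℝ (f' i z) (x - z)) := by
        gcongr with i
        exact (hconv i).sq_norm_gradient_sub_le hL (hgrad i) (hlip i) x z
    _ = 2 * L * (F x - F z - inner ℝ (F' z) (x - z)) := by
        rw [← mul_sum, sum_sub_distrib, sum_sub_distrib, hF, hF, hF', real_inner_smul_left,
          sum_inner]
        ring
    _ ≤ _ := by
        rw [hP, hP]
        exact mul_le_mul_of_nonneg_left (by linarith) (by positivity)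

end MinibatchStep

theorem add_sum_range_le_of_forall_step {D Q : ℕ → ℝ} {u v K : ℝ} {m : ℕ}
    (hstep : ∀ t < m, D (t + 1) + u * Q (t + 1) ≤ D t + v * (Q t + K)) :
    D m + u * ∑ t ∈ Finset.range m, Q (t + 1)
      ≤ D 0 + v * (∑ t ∈ Finset.range m, Q t + m * K) := by
  induction m with
  | zero => simp
  | succ m ih =>
    have h1 := ih fun t ht ↦ hstep t (ht.trans m.lt_succ_self)
    have h2 := hstep m m.lt_succ_self
    rw [Finset.sum_range_succ, Finset.sum_range_succ]
    push_cast
    linarith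

/-- One epoch of mS2GD contracts in expectation (Theorem 1, single outer iteration).
Starting from `x₀`, with `y₀ = x₀` and
`y_{t+1} = prox_{hR}(y_t − h·(∇F(x₀) + (1/b) ∑_{i∈A_t} (∇f_i(y_t) − ∇f_i(x₀))))`
for independent uniformly random `b`-element subsets `A_0,…,A_{m−1}` and
`x₁ = y_T` with `T` uniform on `{1,…,m}`, one has
`E[P(x₁) − P(x*)] ≤ ρ·(P(x₀) − P(x*))` where
`ρ = 1/(m h μ (1 − 4hLα(b))) + 4hLα(b)(m+1)/(m(1 − 4hLα(b)))`. -/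
theorem mS2GD_one_epoch (d n : ℕ) (hd : 1 ≤ d) (hn : 2 ≤ n)
    (f : Fin n → EuclideanSpace ℝ (Fin d) → ℝ)
    (f' : Fin n → EuclideanSpace ℝ (Fin d) → EuclideanSpace ℝ (Fin d))
    (L : ℝ) (hL : 0 < L)
    (hconv : ∀ i, ConvexOn ℝ Set.univ (f i))
    (hgrad : ∀ i x, HasGradientAt (f i) (f' i x) x)
    (hlip : ∀ i x y, ‖f' i x - f' i y‖ ≤ L * ‖x - y‖)
    (F : EuclideanSpace ℝ (Fin d) → ℝ) (hF : ∀ x, F x = (n : ℝ)⁻¹ * ∑ i, f i x)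
    (R : EuclideanSpace ℝ (Fin d) → ℝ) (hRconv : ConvexOn ℝ Set.univ R)
    (hRcont : Continuous R)
    (P : EuclideanSpace ℝ (Fin d) → ℝ) (hP : ∀ x, P x = F x + R x)
    (μ : ℝ) (hμ : 0 < μ)
    (hstrong : ConvexOn ℝ Set.univ (fun x => P x - μ / 2 * ‖x‖ ^ 2))
    (xstar : EuclideanSpace ℝ (Fin d)) (hxstar : ∀ x, P xstar ≤ P x)
    (m : ℕ) (hm : 1 ≤ m)
    (b : ℕ) (hb1 : 1 ≤ b) (hbn : b ≤ n)
    (α : ℝ) (hα : α = ((n : ℝ) - (b : ℝ)) / ((b : ℝ) * ((n : ℝ) - 1)))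
    (h : ℝ) (hh0 : 0 < h) (hhL : h ≤ 1 / L) (hsmall : 4 * h * L * α < 1)
    (prox : EuclideanSpace ℝ (Fin d) → EuclideanSpace ℝ (Fin d))
    (hprox : ∀ z w, (1 / 2) * ‖prox z - z‖ ^ 2 + h * R (prox z)
        ≤ (1 / 2) * ‖w - z‖ ^ 2 + h * R w)
    (x0 : EuclideanSpace ℝ (Fin d))
    (y : (Fin m → Finset (Fin n)) → ℕ → EuclideanSpace ℝ (Fin d))
    (hy0 : ∀ A, y A 0 = x0)
    (hys : ∀ A (t : Fin m), y A (t.val + 1) =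
      prox (y A t.val - h • (((n : ℝ)⁻¹ • ∑ i, f' i x0)
        + (b : ℝ)⁻¹ • ∑ i ∈ A t, (f' i (y A t.val) - f' i x0))))
    (ρ : ℝ) (hρ : ρ = 1 / ((m : ℝ) * h * μ * (1 - 4 * h * L * α))
        + 4 * h * L * α * ((m : ℝ) + 1) / ((m : ℝ) * (1 - 4 * h * L * α))) :
    ((m : ℝ) * ((Fintype.piFinset (fun _ : Fin m =>
        Finset.powersetCard b (Finset.univ : Finset (Fin n)))).card : ℝ))⁻¹ *
      ∑ A ∈ Fintype.piFinset (fun _ : Fin m =>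
          Finset.powersetCard b (Finset.univ : Finset (Fin n))),
        ∑ t ∈ Finset.Icc 1 m, (P (y A t) - P xstar)
      ≤ ρ * (P x0 - P xstar) := by
  have hn0 : (0 : ℝ) < n := by positivity
  have hn1 : (0 : ℝ) < n - 1 := by
    have : (2 : ℝ) ≤ n := mod_cast hn
    linarith
  have hb0 : (0 : ℝ) < b := mod_cast hb1
  have hm0 : (0 : ℝ) < m := mod_cast hm
  have hα0 : 0 ≤ α := by
    have : (0 : ℝ) ≤ n - b := sub_nonneg.2 (mod_cast hbn)
    rw [hα]; positivity
  have hhL' : h * L ≤ 1 := (le_div_iff₀ hL).1 hhL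
  obtain ⟨F', hF'⟩ : ∃ F' : EuclideanSpace ℝ (Fin d) → EuclideanSpace ℝ (Fin d),
      ∀ x, F' x = (n : ℝ)⁻¹ • ∑ i, f' i x := ⟨_, fun _ ↦ rfl⟩
  have hlow : ∀ x w, F x + inner ℝ (F' x) (w - x) ≤ F w := by
    intro x w
    rw [hF, hF, hF', real_inner_smul_left, sum_inner, ← mul_add, ← Finset.sum_add_distrib]
    gcongr with i
    exact (hconv i).add_inner_le_of_hasGradientAt (hgrad i) (hlip i) x w
  have hup : ∀ x w, F w ≤ F x + inner ℝ (F' x) (w - x) + L / 2 * ‖w - x‖ ^ 2 := by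
    intro x w
    have h1 : L / 2 * ‖w - x‖ ^ 2 = (n : ℝ)⁻¹ * ∑ _i : Fin n, L / 2 * ‖w - x‖ ^ 2 := by
      rw [Finset.sum_const, Finset.card_univ, Fintype.card_fin, nsmul_eq_mul,
        inv_mul_cancel_left₀ hn0.ne']
    rw [h1, hF, hF, hF', real_inner_smul_left, sum_inner, ← mul_add, ← mul_add,
      ← Finset.sum_add_distrib, ← Finset.sum_add_distrib]
    gcongr with i
    exact HasGradientAt.le_add_inner_add_sq (hgrad i) (hlip i) x w
  have hgb := sum_sq_norm_gradient_sub_le hL hconv hgrad hlip hF hF' hup hRconv hP hxstar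
  have hdiff : ∀ w, (n : ℝ)⁻¹ * ∑ i, ‖f' i w - f' i x0‖ ^ 2
      ≤ 4 * L * ((P w - P xstar) + (P x0 - P xstar)) := by
    intro w
    have h1 : ∑ i, ‖f' i w - f' i x0‖ ^ 2
        ≤ ∑ i, (2 * ‖f' i w - f' i xstar‖ ^ 2 + 2 * ‖f' i x0 - f' i xstar‖ ^ 2) := by
      refine Finset.sum_le_sum fun i _ ↦ ?_
      have := parallelogram_law_with_norm ℝ (f' i w - f' i xstar) (f' i x0 - f' i xstar)
      rw [sub_sub_sub_cancel_right] at this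
      nlinarith [norm_nonneg (f' i w - f' i xstar + (f' i x0 - f' i xstar))]
    have h2 := mul_le_mul_of_nonneg_left h1 (inv_nonneg.2 hn0.le)
    rw [Finset.sum_add_distrib, ← Finset.mul_sum, ← Finset.mul_sum] at h2
    linarith [hgb w, hgb x0]
  have hloc : ∀ (A : Fin m → Finset (Fin n)) (t : Fin m) (S : Finset (Fin n)) (s : ℕ),
      s ≤ t.val → y (Function.update A t S) s = y A s := by
    intro A t S s
    induction s with
    | zero => intro _; rw [hy0, hy0]
    | succ s ih =>
      intro hs
      have hsm : s < m := by omega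
      have hne : (⟨s, hsm⟩ : Fin m) ≠ t := fun hst ↦ by
        have := congrArg Fin.val hst
        simp only at this
        omega
      have h1 := hys (Function.update A t S) ⟨s, hsm⟩
      have h2 := hys A ⟨s, hsm⟩
      simp only [ih (by omega), Function.update_of_ne hne] at h1
      rw [h1, h2]
  set 𝒜 := Fintype.piFinset fun _ : Fin m ↦ Finset.powersetCard b (Finset.univ : Finset (Fin n))
  set N := (Finset.powersetCard b (Finset.univ : Finset (Fin n))).card with hN
  have hN0 : 0 < N := by
    rw [hN, Finset.card_powersetCard, Finset.card_univ, Fintype.card_fin]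
    exact Nat.choose_pos hbn
  have hM0 : (0 : ℝ) < 𝒜.card := by
    rw [Fintype.card_piFinset]
    exact mod_cast Finset.prod_pos fun _ _ ↦ hN0
  set q := P x0 - P xstar
  have hstep : ∀ t < m, ∑ A ∈ 𝒜, ‖y A (t + 1) - xstar‖ ^ 2
        + 2 * h * ∑ A ∈ 𝒜, (P (y A (t + 1)) - P xstar)
      ≤ ∑ A ∈ 𝒜, ‖y A t - xstar‖ ^ 2
        + 8 * h ^ 2 * L * α * (∑ A ∈ 𝒜, (P (y A t) - P xstar) + 𝒜.card * q) := by
    intro t ht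
    let p : (Fin m → Finset (Fin n)) → Finset (Fin n) → EuclideanSpace ℝ (Fin d) := fun A S ↦
      prox (y A t - h • (F' x0 + (b : ℝ)⁻¹ • ∑ i ∈ S, (f' i (y A t) - f' i x0)))
    have hpy : ∀ A, y A (t + 1) = p A (A ⟨t, ht⟩) := fun A ↦ by
      simp only [p, hF']
      exact hys A ⟨t, ht⟩
    have hpu : ∀ A S, p (Function.update A ⟨t, ht⟩ S) = p A := fun A S ↦ by
      simp only [p, hloc A ⟨t, ht⟩ S t le_rfl]
    have htower := sum_piFinset_sum_apply_eq
      (Finset.powersetCard b (Finset.univ : Finset (Fin n))) (⟨t, ht⟩ : Fin m)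
      (g := fun A S ↦ ‖p A S - xstar‖ ^ 2 + 2 * h * (P (p A S) - P xstar))
      fun A S ↦ by simp only [hpu]
    have hbound : ∀ A ∈ 𝒜, ∑ S ∈ Finset.powersetCard b (Finset.univ : Finset (Fin n)),
        (‖p A S - xstar‖ ^ 2 + 2 * h * (P (p A S) - P xstar))
        ≤ N * (‖y A t - xstar‖ ^ 2 + 8 * h ^ 2 * L * α * ((P (y A t) - P xstar) + q)) := by
      intro A _
      refine (sum_powersetCard_proximal_step_le hn hb1 hbn hlow hup hRconv hP hh0 hhL' hprox xstar
        (y A t) (fun i ↦ f' i (y A t) - f' i x0) (p := p A) fun S ↦ ?_).trans ?_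
      · simp only [p]
        rw [Finset.sum_sub_distrib (s := Finset.univ), smul_sub, ← hF', ← hF', sub_sub_cancel]
      · rw [← hα]
        have h1 := mul_le_mul_of_nonneg_left (hdiff (y A t)) hα0
        have h2 := mul_le_mul_of_nonneg_left h1 (by positivity : 0 ≤ 2 * h ^ 2)
        exact mul_le_mul_of_nonneg_left (by linarith) (Nat.cast_nonneg _)
    have hsum := Finset.sum_le_sum hbound
    rw [htower, ← Finset.mul_sum, nsmul_eq_mul] at hsum
    have h1 := le_of_mul_le_mul_left hsum (Nat.cast_pos.2 hN0)
    simp only [← hpy, Finset.sum_add_distrib, ← Finset.mul_sum, Finset.sum_const,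
      nsmul_eq_mul] at h1
    exact h1
  have htel := add_sum_range_le_of_forall_step (D := fun t ↦ ∑ A ∈ 𝒜, ‖y A t - xstar‖ ^ 2)
    (Q := fun t ↦ ∑ A ∈ 𝒜, (P (y A t) - P xstar)) hstep
  have hQ : ∀ t, 0 ≤ ∑ A ∈ 𝒜, (P (y A t) - P xstar) := fun t ↦
    Finset.sum_nonneg fun A _ ↦ sub_nonneg.2 (hxstar _)
  have hD : 0 ≤ ∑ A ∈ 𝒜, ‖y A m - xstar‖ ^ 2 := Finset.sum_nonneg fun A _ ↦ by positivity
  have hshift := (Finset.sum_range_succ' (fun t ↦ ∑ A ∈ 𝒜, (P (y A t) - P xstar)) m).symm.trans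
    (Finset.sum_range_succ (fun t ↦ ∑ A ∈ 𝒜, (P (y A t) - P xstar)) m)
  simp only [hy0, Finset.sum_const, nsmul_eq_mul] at htel hshift
  have hsc := sq_norm_sub_le_of_strongly_convex hstrong hxstar x0
  have hIcc : ∑ A ∈ 𝒜, ∑ t ∈ Finset.Icc 1 m, (P (y A t) - P xstar)
      = ∑ t ∈ Finset.range m, ∑ A ∈ 𝒜, (P (y A (t + 1)) - P xstar) := by
    rw [Finset.sum_comm, Finset.range_eq_Ico, Finset.sum_Ico_add' (fun t ↦
      ∑ A ∈ 𝒜, (P (y A t) - P xstar)) 0 m 1]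
    rfl
  rw [hIcc]
  set G := ∑ t ∈ Finset.range m, ∑ A ∈ 𝒜, (P (y A (t + 1)) - P xstar)
  set M := (𝒜.card : ℝ)
  have hθ : 0 < 1 - 4 * h * L * α := by linarith
  have hsum_le : ∑ t ∈ Finset.range m, ∑ A ∈ 𝒜, (P (y A t) - P xstar) ≤ G + M * q := by
    linarith [hQ m]
  have hdist : M * ‖x0 - xstar‖ ^ 2 ≤ M * (2 / μ * q) := by
    gcongr
    rw [div_mul_eq_mul_div, le_div_iff₀ hμ]
    linarith
  have hmain : 2 * h * (1 - 4 * h * L * α) * G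
      ≤ M * (2 / μ * q + 8 * h ^ 2 * L * α * (m + 1) * q) := by
    have := mul_le_mul_of_nonneg_left (add_le_add_left hsum_le (m * (M * q)))
      (by positivity : 0 ≤ 8 * h ^ 2 * L * α)
    linarith
  have hρq : ρ * q = (m * M)⁻¹ * (M * (2 / μ * q + 8 * h ^ 2 * L * α * (m + 1) * q)
      / (2 * h * (1 - 4 * h * L * α))) := by
    rw [hρ]
    field_simp
    ring
  rw [hρq]
  gcongr
  rw [le_div_iff₀ (by positivity)]
  linarith
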